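/- Let m and m' be integers with m ≥ 3 and m' - 2 = k(m - 2) for some positive integer k. If n_m = p·(m-2)^{m-2} for some real number p, then n_{m'} ≤ p·(m'-2)^{m'-2}. -/

import Mathlib

/-- A graph `G` is `k`-choosable if for every assignment of lists of `k` colors
to the vertices there is a proper coloring choosing each vertex's color from its list. -/
def Choosable {V : Type*} (G : SimpleGraph V) (k : ℕ) : Prop :=
  ∀ L : V → Finset ℕ, (∀ v, (L v).card = k) →
    ∃ c : V → ℕ, (∀ v, c v ∈ L v) ∧ ∀ u w, G.Adj u w → c u ≠ c w

/-- The choice number of `G` is the least `k` such that `G` is `k`-choosable. -/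
noncomputable def choiceNumber {V : Type*} (G : SimpleGraph V) : ℕ :=
  sInf {k | Choosable G k}

/-- `nm m` is the smallest integer `n` such that `ch (K_{m,n}) = m - 1`. -/
noncomputable def nm (m : ℕ) : ℕ :=
  sInf {n | choiceNumber (completeBipartiteGraph (Fin m) (Fin n)) = m - 1}

theorem Choosable.choiceNumber_le {V : Type*} {G : SimpleGraph V} {k : ℕ}
    (h : Choosable G k) : choiceNumber G ≤ k :=
  Nat.sInf_le h

/-- Choosability is monotone in the list size. -/
theorem Choosable.mono {V : Type*} {G : SimpleGraph V} {j k : ℕ} (h : Choosable G j)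
    (hjk : j ≤ k) : Choosable G k := by
  intro L hL
  choose M hM hMc using fun v => Finset.exists_subset_card_eq (hjk.trans (hL v).ge)
  obtain ⟨c, hc, hadj⟩ := h M hMc
  exact ⟨c, fun v => hM v (hc v), hadj⟩

/-- Choosability does not depend on the countable type the colors are taken from. -/
theorem Choosable.exists_coloring {V C : Type*} [Countable C] {G : SimpleGraph V} {k : ℕ}
    (h : Choosable G k) (L : V → Finset C) (hL : ∀ v, (L v).card = k) :
    ∃ c : V → C, (∀ v, c v ∈ L v) ∧ ∀ u w, G.Adj u w → c u ≠ c w := by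
  obtain ⟨f, hf⟩ := exists_injective_nat C
  obtain ⟨c, hc, hadj⟩ := h (fun v => (L v).map ⟨f, hf⟩) (by simpa using hL)
  simp only [Finset.mem_map, Function.Embedding.coeFn_mk] at hc
  choose d hd hdc using hc
  refine ⟨d, hd, fun u w huw heq => hadj u w huw ?_⟩
  rw [← hdc u, ← hdc w, heq]

/-- Choosability transfers along graph isomorphisms. -/
theorem Choosable.of_iso {V W : Type*} {G : SimpleGraph V} {H : SimpleGraph W} {k : ℕ}
    (h : Choosable G k) (e : G ≃g H) : Choosable H k := by
  intro L hL
  obtain ⟨c, hc, hadj⟩ := h (fun v => L (e v)) (fun v => hL _)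
  refine ⟨fun w => c (e.symm w), fun w => by simpa using hc (e.symm w), fun u w huw => ?_⟩
  exact hadj _ _ (e.symm.map_adj_iff.2 huw)

/-- A complete bipartite graph with an empty part is `1`-choosable. -/
theorem choosable_completeBipartiteGraph_zero (m : ℕ) :
    Choosable (completeBipartiteGraph (Fin m) (Fin 0)) 1 := by
  intro L hL
  have hne : ∀ v, (L v).Nonempty := fun v => Finset.card_pos.1 (by simp [hL v])
  choose c hc using hne
  refine ⟨c, hc, ?_⟩
  rintro (u | u) (w | w) huw
  · simp at huw
  · exact w.elim0
  · exact u.elim0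
  · exact u.elim0

/-- Adding a vertex to one part raises the list size needed by at most one. -/
theorem Choosable.completeBipartiteGraph_succ {m n k : ℕ}
    (h : Choosable (completeBipartiteGraph (Fin m) (Fin n)) k) :
    Choosable (completeBipartiteGraph (Fin m) (Fin (n + 1))) (k + 1) := by
  intro L hL
  obtain ⟨c₀, hc₀⟩ : (L (.inr (Fin.last n))).Nonempty := Finset.card_pos.1 (by simp [hL])
  have hcard : ∀ v, k ≤ ((L v).erase c₀).card := fun v => by
    have := Finset.pred_card_le_card_erase (s := L v) (a := c₀)
    rw [hL] at this
    simpa using this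
  choose M hM hMc using fun v => Finset.exists_subset_card_eq (hcard v)
  obtain ⟨c, hc, hadj⟩ := h (fun v => M (Sum.map id Fin.castSucc v)) (fun v => hMc _)
  have hmem := fun v => Finset.mem_erase.1 (hM _ (hc v))
  have hab : ∀ (a : Fin m) (b : Fin (n + 1)),
      c (.inl a) ≠ Fin.lastCases (motive := fun _ => ℕ) c₀ (fun i => c (.inr i)) b := by
    intro a b
    induction b using Fin.lastCases with
    | last => simpa using (hmem (.inl a)).1
    | cast i => simpa using hadj (.inl a) (.inr i) (by simp)
  refine ⟨Sum.elim (fun a => c (.inl a)) (Fin.lastCases c₀ fun i => c (.inr i)), ?_, ?_⟩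
  · rintro (a | b)
    · exact (hmem (.inl a)).2
    · induction b using Fin.lastCases with
      | last => simpa using hc₀
      | cast i => simpa using (hmem (.inr i)).2
  · rintro (u | u) (w | w) huw
    · simp at huw
    · exact hab u w
    · exact (hab w u).symm
    · simp at huw

theorem exists_choosable_completeBipartiteGraph (m n : ℕ) :
    ∃ k, Choosable (completeBipartiteGraph (Fin m) (Fin n)) k := by
  induction n with
  | zero => exact ⟨1, choosable_completeBipartiteGraph_zero m⟩
  | succ n ih => exact ih.imp' _ fun _ h => h.completeBipartiteGraph_succ

theorem choosable_choiceNumber_completeBipartiteGraph (m n : ℕ) :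
    Choosable (completeBipartiteGraph (Fin m) (Fin n))
      (choiceNumber (completeBipartiteGraph (Fin m) (Fin n))) :=
  Nat.sInf_mem (exists_choosable_completeBipartiteGraph m n)

/-- If `K_{m,N}` is not `s`-choosable, then some `K_{m,n}` with `n ≤ N` has choice number
exactly `s + 1`. -/
theorem exists_le_choiceNumber_eq {m N s : ℕ}
    (h : ¬ Choosable (completeBipartiteGraph (Fin m) (Fin N)) s) :
    ∃ n ≤ N, choiceNumber (completeBipartiteGraph (Fin m) (Fin n)) = s + 1 := by
  classical
  have hN : s + 1 ≤ choiceNumber (completeBipartiteGraph (Fin m) (Fin N)) := by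
    by_contra! hlt
    exact h ((choosable_choiceNumber_completeBipartiteGraph m N).mono (by omega))
  have hex : ∃ n, s + 1 ≤ choiceNumber (completeBipartiteGraph (Fin m) (Fin n)) := ⟨N, hN⟩
  refine ⟨Nat.find hex, Nat.find_min' hex hN, le_antisymm ?_ (Nat.find_spec hex)⟩
  rcases hn : Nat.find hex with _ | n
  · have := (choosable_completeBipartiteGraph_zero m).choiceNumber_le
    omega
  · have hlt := Nat.find_min hex (m := n) (by omega)
    have := (choosable_choiceNumber_completeBipartiteGraph
      m n).completeBipartiteGraph_succ.choiceNumber_le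
    omega

/-- A list assignment showing that `K_{A,B}` is not `s`-choosable gives one showing that a
larger complete bipartite graph is not `k * s`-choosable: replace each color by `k` copies, and
add to the first part a set `E` of vertices with pairwise disjoint lists of new colors. -/
theorem not_choosable_completeBipartiteGraph_blowup {A B E : Type*} [Fintype E]
    {s k : ℕ} (hE : s + Fintype.card E = k * s)
    (h : ¬ Choosable (completeBipartiteGraph A B) s) :
    ¬ Choosable (completeBipartiteGraph (A ⊕ E)
      (B × (Fin s → Fin k) × (E → Fin (k * s)))) (k * s) := by
  intro hch
  apply h
  intro L hL
  let idx : ∀ b : B, L (.inr b) ≃ Fin s := fun b => Finset.equivFinOfCardEq (hL _)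
  let L' : (A ⊕ E) ⊕ (B × (Fin s → Fin k) × (E → Fin (k * s))) →
      Finset ((ℕ × Fin k) ⊕ (E × Fin (k * s))) := Sum.elim
    (Sum.elim (fun a => (L (.inl a) ×ˢ Finset.univ).disjSum ∅)
      (fun e => (∅ : Finset (ℕ × Fin k)).disjSum ({e} ×ˢ Finset.univ)))
    (fun b => (Finset.univ.map ⟨fun i => (((idx b.1).symm i : ℕ), b.2.1 i), by
        intro i j hij
        simpa [Subtype.val_inj] using congrArg Prod.fst hij⟩).disjSum
      (Finset.univ.map ⟨fun e => (e, b.2.2 e), fun e e' hee => congrArg Prod.fst hee⟩))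
  have hL' : ∀ v, (L' v).card = k * s := by
    rintro ((a | e) | b)
    · simp [L', hL, mul_comm]
    · simp [L']
    · simp [L', hE]
  obtain ⟨c, hc, hadj⟩ := hch.exists_coloring L' hL'
  have hA : ∀ a, ∃ x ∈ L (.inl a), ∃ y, c (.inl (.inl a)) = .inl (x, y) := by
    intro a
    have := hc (.inl (.inl a))
    rcases hca : c (.inl (.inl a)) with ⟨x, y⟩ | z
    · rw [hca] at this
      exact ⟨x, by simpa [L'] using this, y, rfl⟩
    · rw [hca] at this
      simp [L'] at this
  have hEc : ∀ e, ∃ y, c (.inl (.inr e)) = .inr (e, y) := by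
    intro e
    have := hc (.inl (.inr e))
    rcases hce : c (.inl (.inr e)) with z | ⟨x, y⟩
    · rw [hce] at this
      simp [L'] at this
    · rw [hce] at this
      obtain rfl : e = x := by simpa [L', eq_comm] using this
      exact ⟨y, rfl⟩
  choose x hx y hxy using hA
  choose g hg using hEc
  have hB : ∀ b, ∃ z ∈ L (.inr b), ∀ a, x a ≠ z := by
    intro b
    by_contra! hcon
    choose r hr using fun i => hcon ((idx b).symm i) ((idx b).symm i).2
    have hmem := hc (.inr (b, fun i => y (r i), g))
    simp only [L', Sum.elim_inr, Finset.mem_disjSum, Finset.mem_map, Finset.mem_univ,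
      true_and] at hmem
    rcases hmem with ⟨_, ⟨i, rfl⟩, hi⟩ | ⟨_, ⟨e, rfl⟩, he⟩
    · exact hadj (.inl (.inl (r i))) (.inr _) (by simp) (by rw [← hi, hxy, hr]; rfl)
    · exact hadj (.inl (.inr e)) (.inr _) (by simp) (by rw [← he, hg]; rfl)
  choose z hz hxz using hB
  refine ⟨Sum.elim x z, ?_, ?_⟩
  · rintro (a | b)
    · exact hx a
    · exact hz b
  · rintro (u | u) (w | w) huw
    · simp at huw
    · exact hxz w u
    · exact (hxz u w).symm
    · simp at huw

/-- The blow-up construction for complete bipartite graphs on `Fin`. -/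
theorem not_choosable_completeBipartiteGraph_fin {s k n : ℕ} (hk : 1 ≤ k)
    (h : ¬ Choosable (completeBipartiteGraph (Fin (s + 2)) (Fin n)) s) :
    ¬ Choosable (completeBipartiteGraph (Fin (k * s + 2))
      (Fin (n * (k ^ s * (k * s) ^ (k * s - s))))) (k * s) := by
  have hs : s ≤ k * s := Nat.le_mul_of_pos_left s hk
  intro hch
  refine not_choosable_completeBipartiteGraph_blowup (E := Fin (k * s - s)) (k := k)
    (by simpa using Nat.add_sub_cancel' hs) h (hch.of_iso ?_)
  have e₁ : Fin (k * s + 2) ≃ Fin (s + 2) ⊕ Fin (k * s - s) :=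
    Fintype.equivOfCardEq (by simp; omega)
  have e₂ : Fin (n * (k ^ s * (k * s) ^ (k * s - s))) ≃
      Fin n × (Fin s → Fin k) × (Fin (k * s - s) → Fin (k * s)) :=
    Fintype.equivOfCardEq (by simp)
  exact SimpleGraph.completeBipartiteGraphCongr e₁ e₂

theorem not_choosable_completeBipartiteGraph_three_one :
    ¬ Choosable (completeBipartiteGraph (Fin (1 + 2)) (Fin 1)) 1 := by
  intro h
  obtain ⟨c, hc, hadj⟩ := h (fun _ => {0}) (by simp)
  simp only [Finset.mem_singleton] at hc
  exact hadj (.inl 0) (.inr 0) (by simp) (by rw [hc, hc])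

/-- `K_{m,n}` with `n = nm m` is not `(m - 2)`-choosable. -/
theorem not_choosable_nm {s : ℕ} (hs : 1 ≤ s) :
    ¬ Choosable (completeBipartiteGraph (Fin (s + 2)) (Fin (nm (s + 2)))) s := by
  have h₁ := not_choosable_completeBipartiteGraph_fin hs
    not_choosable_completeBipartiteGraph_three_one
  rw [mul_one] at h₁
  obtain ⟨n, -, hn⟩ := exists_le_choiceNumber_eq h₁
  have hmem : choiceNumber (completeBipartiteGraph (Fin (s + 2)) (Fin (nm (s + 2)))) = s + 1 :=
    Nat.sInf_mem (s := {n | choiceNumber (completeBipartiteGraph (Fin (s + 2)) (Fin n)) =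
      s + 2 - 1}) ⟨n, hn⟩
  intro hch
  have := hch.choiceNumber_le
  omega

/-- If `m' - 2 = k (m - 2)` for a positive integer `k`, and `n_m = p (m-2)^(m-2)`,
then `n_{m'} ≤ p (m'-2)^(m'-2)`. -/
theorem nm_scaling (m m' k : ℕ) (hm : 3 ≤ m) (hk : 1 ≤ k)
    (hmm' : m' - 2 = k * (m - 2)) (p : ℝ)
    (hp : (nm m : ℝ) = p * ((m : ℝ) - 2) ^ (m - 2)) :
    (nm m' : ℝ) ≤ p * ((m' : ℝ) - 2) ^ (m' - 2) := by
  obtain ⟨s, rfl⟩ : ∃ s, m = s + 2 := ⟨m - 2, by omega⟩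
  rw [Nat.add_sub_cancel] at hmm' hp
  have hs : 1 ≤ s := by omega
  have hks : s ≤ k * s := Nat.le_mul_of_pos_left s hk
  obtain rfl : m' = k * s + 2 := by omega
  obtain ⟨n, hnN, hn⟩ := exists_le_choiceNumber_eq
    (not_choosable_completeBipartiteGraph_fin hk (not_choosable_nm hs))
  have hle : nm (k * s + 2) ≤ nm (s + 2) * (k ^ s * (k * s) ^ (k * s - s)) :=
    (Nat.sInf_le (by simpa using hn)).trans hnN
  have hleR : (nm (k * s + 2) : ℝ) ≤ nm (s + 2) * (k ^ s * (k * s) ^ (k * s - s)) := by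
    exact_mod_cast hle
  refine hleR.trans_eq ?_
  have hpow : ((k : ℝ) * s) ^ (k * s) = (k * s) ^ s * (k * s) ^ (k * s - s) := by
    rw [← pow_add, Nat.add_sub_cancel' hks]
  rw [hp, Nat.add_sub_cancel]
  push_cast
  rw [add_sub_cancel_right, add_sub_cancel_right, hpow, mul_pow (k : ℝ) s s]
  ring
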